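/- Let Δ0 be an MCS containing K_x y = T_y, K_y x = T_x, x ≡ c_x, y ≡ c_y (with T_y ∪ T_x ∪ {c_x,c_y} ⊆ Cons), and let M^{Δ0} = (D, I, Σ, ∼) be the induced canonical model. Then: (1) for any c ∈ T_y with ¬c≡c_y ∈ Δ0, the set {K_x y = T_y, y≡c, ¬c≡c_y, K_y x≡c_x} is consistent with Γ := {α ∈ L_B : α ∈ Δ0 and all terms of α are constants} (and symmetrically for x), so when such constants c exist there are MCSs in Σ containing these sets; (2) every Δ ∈ Σ assigns exactly one value to each of x and y; and (3) for any Δ1, Δ2 ∈ Σ, if Δ1(x) = Δ2(x) and Δ1(y) = Δ2(y), then Δ1 = Δ2. -/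

import Mathlib

/-! Core definitions for the Epistemic Logic of Cops and Robbers (ELCR). -/

/-- The two players/variables. -/
inductive Var : Type
  | x | y
  deriving DecidableEq

/-- The other variable. -/
def Var.other : Var → Var
  | .x => .y
  | .y => .x

/-- Terms: constants or variables. -/
inductive Term (Cons : Type) : Type
  | const (c : Cons)
  | var (v : Var)
  deriving DecidableEq

/-- Formulas of the full language `L` (with movement modalities). -/
inductive Form (Pred Cons : Type) : Type
  | pred (P : Pred) (args : List (Term Cons))
  | rel (t₁ t₂ : Term Cons)
  | eq (t₁ t₂ : Term Cons)
  | neg (φ : Form Pred Cons)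
  | and (φ ψ : Form Pred Cons)
  | Kt (z : Var) (t : Term Cons)
  | K (z : Var) (φ : Form Pred Cons)
  | box (z : Var) (φ : Form Pred Cons)

namespace Form

variable {Pred Cons : Type}

def imp (φ ψ : Form Pred Cons) : Form Pred Cons := .neg (.and φ (.neg ψ))
def or (φ ψ : Form Pred Cons) : Form Pred Cons := .neg (.and (.neg φ) (.neg ψ))
def iffF (φ ψ : Form Pred Cons) : Form Pred Cons := .and (imp φ ψ) (imp ψ φ)
def falseF : Form Pred Cons := .neg (.eq (.var .x) (.var .x))
def trueF : Form Pred Cons := .neg falseF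
/-- `⟨K_z⟩φ := ¬K_z¬φ`. -/
def diaK (z : Var) (φ : Form Pred Cons) : Form Pred Cons := .neg (.K z (.neg φ))

def bigAnd : List (Form Pred Cons) → Form Pred Cons
  | [] => trueF
  | φ :: l => .and φ (bigAnd l)

def bigOr : List (Form Pred Cons) → Form Pred Cons
  | [] => falseF
  | φ :: l => or φ (bigOr l)

/-- Membership in the Boolean base language `L_B`. -/
def isBase : Form Pred Cons → Prop
  | .pred _ _ => True
  | .rel _ _ => True
  | .eq _ _ => True
  | .neg φ => isBase φ
  | .and φ ψ => isBase φ ∧ isBase ψ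
  | .Kt _ _ => False
  | .K _ _ => False
  | .box _ _ => False

/-- Membership in `L_BD` (Booleans plus movement modalities). -/
def isBD : Form Pred Cons → Prop
  | .pred _ _ => True
  | .rel _ _ => True
  | .eq _ _ => True
  | .neg φ => isBD φ
  | .and φ ψ => isBD φ ∧ isBD ψ
  | .Kt _ _ => False
  | .K _ _ => False
  | .box _ φ => isBD φ

/-- Membership in the full language `L`. -/
def isL : Form Pred Cons → Prop
  | .pred _ _ => True
  | .rel _ _ => True
  | .eq _ _ => True
  | .neg φ => isL φ
  | .and φ ψ => isL φ ∧ isL ψ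
  | .Kt _ _ => True
  | .K _ ψ => isBD ψ
  | .box _ φ => isL φ

/-- Membership in the static fragment `L⁻`: no movement modalities, and the
knowledge operator `K_z` is applied to `L_B`-formulas only. -/
def isStatic : Form Pred Cons → Prop
  | .pred _ _ => True
  | .rel _ _ => True
  | .eq _ _ => True
  | .neg φ => isStatic φ
  | .and φ ψ => isStatic φ ∧ isStatic ψ
  | .Kt _ _ => True
  | .K _ φ => isBase φ
  | .box _ _ => False

/-- The variable `z` occurs in the formula. -/
def occurs (z : Var) : Form Pred Cons → Prop
  | .pred _ args => Term.var z ∈ args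
  | .rel t₁ t₂ => t₁ = Term.var z ∨ t₂ = Term.var z
  | .eq t₁ t₂ => t₁ = Term.var z ∨ t₂ = Term.var z
  | .neg φ => occurs z φ
  | .and φ ψ => occurs z φ ∨ occurs z ψ
  | .Kt w t => w = z ∨ t = Term.var z
  | .K w φ => w = z ∨ occurs z φ
  | .box w φ => w = z ∨ occurs z φ

/-- The list of terms occurring in a formula. -/
def termList : Form Pred Cons → List (Term Cons)
  | .pred _ args => args
  | .rel t₁ t₂ => [t₁, t₂]
  | .eq t₁ t₂ => [t₁, t₂]
  | .neg φ => termList φ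
  | .and φ ψ => termList φ ++ termList ψ
  | .Kt _ t => [t]
  | .K _ φ => termList φ
  | .box _ φ => termList φ

end Form

/-- Substituting the constant `c` for the variable `z` in a term. -/
def Term.substC {Cons : Type} (c : Cons) (z : Var) : Term Cons → Term Cons
  | .var v => if v = z then .const c else .var v
  | .const c' => .const c'

/-- `φ.substC c z` is `φ[c/z]`. -/
def Form.substC {Pred Cons : Type} (c : Cons) (z : Var) : Form Pred Cons → Form Pred Cons
  | .pred P args => .pred P (args.map (Term.substC c z))
  | .rel t₁ t₂ => .rel (t₁.substC c z) (t₂.substC c z)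
  | .eq t₁ t₂ => .eq (t₁.substC c z) (t₂.substC c z)
  | .neg φ => .neg (φ.substC c z)
  | .and φ ψ => .and (φ.substC c z) (ψ.substC c z)
  | .Kt w t => .Kt w (t.substC c z)
  | .K w φ => .K w (φ.substC c z)
  | .box w φ => .box w (φ.substC c z)

/-- Replacing the term `t₂` by the term `t₁`. -/
def Term.repl {Cons : Type} [DecidableEq Cons] (t₁ t₂ t : Term Cons) : Term Cons :=
  if t = t₂ then t₁ else t

/-- `φ.replace t₁ t₂` is `φ[t₁/t₂]`: the result of replacing `t₂` in `φ` with `t₁`. -/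
def Form.replace {Pred Cons : Type} [DecidableEq Cons] (t₁ t₂ : Term Cons) :
    Form Pred Cons → Form Pred Cons
  | .pred P args => .pred P (args.map (Term.repl t₁ t₂))
  | .rel s₁ s₂ => .rel (Term.repl t₁ t₂ s₁) (Term.repl t₁ t₂ s₂)
  | .eq s₁ s₂ => .eq (Term.repl t₁ t₂ s₁) (Term.repl t₁ t₂ s₂)
  | .neg φ => .neg (φ.replace t₁ t₂)
  | .and φ ψ => .and (φ.replace t₁ t₂) (ψ.replace t₁ t₂)
  | .Kt w t => .Kt w (Term.repl t₁ t₂ t)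
  | .K w φ => .K w (φ.replace t₁ t₂)
  | .box w φ => .box w (φ.replace t₁ t₂)

/-- The list of all terms (constants and variables), for finite `Cons`. -/
noncomputable def allTerms (Cons : Type) [Fintype Cons] : List (Term Cons) :=
  (Finset.univ : Finset Cons).toList.map Term.const ++ [Term.var .x, Term.var .y]

/-- The syntactic distance formulas `D^n t₁ t₂`. -/
noncomputable def distForm (Pred : Type) {Cons : Type} [Fintype Cons] :
    ℕ → Term Cons → Term Cons → Form Pred Cons
  | 0, t₁, t₂ => .eq t₁ t₂
  | n + 1, t₁, t₂ =>
      Form.or (distForm Pred n t₁ t₂)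
        (Form.bigOr ((allTerms Cons).map fun t =>
          Form.and (distForm Pred n t₁ t) (Form.or (.rel t t₂) (.rel t₂ t))))

/-- `K_z z' = T`: the set `T` consists of the possible positions of `z'` considered by `z`. -/
noncomputable def KzEqSet {Pred Cons : Type} [Fintype Cons] [DecidableEq Cons]
    (z z' : Var) (T : Finset Cons) : Form Pred Cons :=
  Form.bigAnd
    ((T.toList.map fun c => Form.diaK z (.eq (.var z') (.const c))) ++
      (Tᶜ.toList.map fun c => Form.K z (.neg (.eq (.var z') (.const c)))))

/-- `Rz = T`: `T` is exactly the set of (names of) R-successors of `z`. -/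
noncomputable def RzEqSet {Pred Cons : Type} [Fintype Cons] [DecidableEq Cons]
    (z : Var) (T : Finset Cons) : Form Pred Cons :=
  Form.bigAnd
    ((T.toList.map fun c => Form.rel (.var z) (.const c)) ++
      (Tᶜ.toList.map fun c => Form.neg (Form.rel (.var z) (.const c))))

/-- The list of all subsets of `Cons`. -/
noncomputable def powList (Cons : Type) [Fintype Cons] [DecidableEq Cons] : List (Finset Cons) :=
  (Finset.univ : Finset Cons).powerset.toList

/-! ### Semantics -/

/-- An interpretation of the vocabulary over a domain `D`. -/
structure Interp (Pred Cons D : Type) where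
  pred : Pred → List D → Prop
  rel : D → D → Prop
  const : Cons → D

/-- Assignments (situations): positions of the two players. -/
abbrev Assign (D : Type) := Var → D

/-- The value of a term at an interpretation and a situation. -/
def Term.val {Pred Cons D : Type} (I : Interp Pred Cons D) (σ : Assign D) :
    Term Cons → D
  | .const c => I.const c
  | .var v => σ v

/-- `Dball I m s` is `D^m(s)`: points reachable from `s` in at most `m` steps
along `I.rel` or its converse. -/
def Dball {Pred Cons D : Type} (I : Interp Pred Cons D) : ℕ → D → Set D
  | 0, s => {s}
  | m + 1, s => Dball I m s ∪ {t | ∃ u ∈ Dball I m s, I.rel u t ∨ I.rel t u}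

/-- `R^z σ σ'`: player `z` moves along an arrow, the other player stays put. -/
def Rstep {Pred Cons D : Type} (I : Interp Pred Cons D) (z : Var) (σ σ' : Assign D) : Prop :=
  I.rel (σ z) (σ' z) ∧ σ z.other = σ' z.other

/-- Indistinguishability data: a relation on assignments for each player. -/
abbrev SimRel (D : Type) := Var → Assign D → Assign D → Prop

/-- `Σ|σ`: the situations related to `σ` by some player's indistinguishability. -/
def restrict {D : Type} (Sit : Set (Assign D)) (sim : SimRel D) (σ : Assign D) :
    Set (Assign D) :=
  {σ' ∈ Sit | ∃ z, sim z σ σ'}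

/-- The updated set of situations after player `z` moves from `σ₁` to `σ₂`. -/
def updSit {Pred Cons D : Type} (k : ℕ) (I : Interp Pred Cons D)
    (Sit : Set (Assign D)) (sim : SimRel D) (z : Var) (σ₁ σ₂ : Assign D) :
    Set (Assign D) :=
  {σ' | (σ₂ Var.x ∈ Dball I k (σ₂ Var.y) ∧ σ' = σ₂) ∨
        (σ₂ Var.x ∉ Dball I k (σ₂ Var.y) ∧
          (∃ σ ∈ restrict Sit sim σ₁, Rstep I z σ σ') ∧
          σ' Var.x ∉ Dball I k (σ' Var.y))}

/-- The updated indistinguishability relations: `σ₁ ∼'_z σ₂` iff `σ₁ z = σ₂ z`. -/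
def updSim (D : Type) : SimRel D := fun z σ₁ σ₂ => σ₁ z = σ₂ z

/-- Satisfaction for `ELCR` (with sight `k`). -/
def Sat {Pred Cons D : Type} (k : ℕ) (I : Interp Pred Cons D) :
    Set (Assign D) → SimRel D → Assign D → Form Pred Cons → Prop
  | _, _, σ, .pred P args => I.pred P (args.map (Term.val I σ))
  | _, _, σ, .rel t₁ t₂ => I.rel (t₁.val I σ) (t₂.val I σ)
  | _, _, σ, .eq t₁ t₂ => t₁.val I σ = t₂.val I σ
  | Sit, sim, σ, .neg φ => ¬ Sat k I Sit sim σ φ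
  | Sit, sim, σ, .and φ ψ => Sat k I Sit sim σ φ ∧ Sat k I Sit sim σ ψ
  | Sit, sim, σ, .Kt z t => ∀ σ' ∈ Sit, sim z σ' σ → t.val I σ = t.val I σ'
  | Sit, sim, σ, .K z φ => ∀ σ' ∈ Sit, sim z σ' σ → Sat k I Sit sim σ' φ
  | Sit, sim, σ, .box z φ => ∀ σ₂, Rstep I z σ σ₂ →
      Sat k I (updSit k I Sit sim z σ σ₂) (updSim D) σ₂ φ

/-- The conditions making `(D, I, Σ, ∼)` a model: seriality of `I.rel`, every
point named by a constant, `Σ` nonempty, and each `∼_z` an equivalence relation on `Σ`. -/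
structure IsModel {Pred Cons D : Type} (I : Interp Pred Cons D)
    (Sit : Set (Assign D)) (sim : SimRel D) : Prop where
  serial : ∀ s, ∃ t, I.rel s t
  const_surj : Function.Surjective I.const
  nonempty : Sit.Nonempty
  sim_mem : ∀ z σ σ', sim z σ σ' → σ ∈ Sit ∧ σ' ∈ Sit
  sim_refl : ∀ z, ∀ σ ∈ Sit, sim z σ σ
  sim_symm : ∀ z σ σ', sim z σ σ' → sim z σ' σ
  sim_trans : ∀ z σ₁ σ₂ σ₃, sim z σ₁ σ₂ → sim z σ₂ σ₃ → sim z σ₁ σ₃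

/-- The `k`-sight condition. -/
def KSight {Pred Cons D : Type} (k : ℕ) (I : Interp Pred Cons D)
    (Sit : Set (Assign D)) (sim : SimRel D) : Prop :=
  ∀ z σ σ', σ ∈ Sit → σ' ∈ Sit → sim z σ σ' →
    ∀ z', σ z' ∈ Dball I k (σ z) → σ z' = σ' z'

/-- A nonempty conjunction `K_zα₁ ∧ ⋯ ∧ K_zαₙ ∧ ⟨K_z⟩β₁ ∧ ⋯ ∧ ⟨K_z⟩βₘ`. -/
def kConj {Pred Cons : Type} (z : Var) (αs βs : List (Form Pred Cons)) :
    Form Pred Cons :=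
  Form.bigAnd (αs.map (Form.K z) ++ βs.map (Form.diaK z))
/-! ### The proof system ELCR⁻ -/

/-- Evaluation of a formula under a propositional valuation of its non-Boolean
components: used to define propositional tautologies. -/
def Form.evalProp {Pred Cons : Type} (v : Form Pred Cons → Prop) :
    Form Pred Cons → Prop
  | .neg φ => ¬ Form.evalProp v φ
  | .and φ ψ => Form.evalProp v φ ∧ Form.evalProp v ψ
  | φ => v φ

/-- Propositional tautologies. -/
def Form.Tautology {Pred Cons : Type} (φ : Form Pred Cons) : Prop :=
  ∀ v : Form Pred Cons → Prop, Form.evalProp v φ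

/-- The Hilbert-style proof system `ELCR⁻` for the static fragment, with sight `k`. -/
inductive Prov {Pred Cons : Type} [Fintype Cons] [DecidableEq Cons] (k : ℕ) :
    Form Pred Cons → Prop
  | taut {φ : Form Pred Cons} : φ.isStatic → φ.Tautology → Prov k φ
  | mp {φ ψ : Form Pred Cons} : Prov k (φ.imp ψ) → Prov k φ → Prov k ψ
  | eqRefl (t : Term Cons) : Prov k (.eq t t)
  | eqSymm (t₁ t₂ : Term Cons) : Prov k ((Form.eq t₁ t₂).imp (.eq t₂ t₁))
  | eqTrans (t₁ t₂ t₃ : Term Cons) :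
      Prov k (((Form.eq t₁ t₂).and (.eq t₂ t₃)).imp (.eq t₁ t₃))
  | eqSubst {α : Form Pred Cons} (t₁ t₂ : Term Cons) : α.isBase →
      Prov k ((Form.eq t₁ t₂).imp (α.iffF (α.replace t₁ t₂)))
  | seriality (c : Cons) :
      Prov k (Form.bigOr ((Finset.univ : Finset Cons).toList.map fun t =>
        Form.rel (.const c) (.const t)))
  | atSomewhere (z : Var) :
      Prov k (Form.bigOr ((Finset.univ : Finset Cons).toList.map fun c =>
        Form.eq (.var z) (.const c)))
  | ksight (z : Var) (t : Term Cons) :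
      Prov k ((distForm Pred k (.var z) t).imp (.Kt z t))
  | kAx {α β : Form Pred Cons} (z : Var) : α.isBase → β.isBase →
      Prov k ((Form.K z (α.imp β)).imp ((Form.K z α).imp (.K z β)))
  | tAx {α : Form Pred Cons} (z : Var) : α.isBase →
      Prov k ((Form.K z α).imp α)
  | kGround {α : Form Pred Cons} (z : Var) (T : Finset Cons) : α.isBase →
      Prov k ((KzEqSet z z.other T).imp
        ((Form.K z α).iffF (Form.bigAnd (T.toList.map fun c => α.substC c z.other))))
  | kAdd {α : Form Pred Cons} (z : Var) (αs βs : List (Form Pred Cons)) :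
      α.isBase → (∀ γ ∈ αs, γ.isBase) → (∀ γ ∈ βs, γ.isBase) →
      1 ≤ αs.length + βs.length →
      Prov k ((kConj z αs βs).imp α) → Prov k ((kConj z αs βs).imp (.K z α))
  | kElim {α β : Form Pred Cons} (z : Var) (αs βs : List (Form Pred Cons)) :
      α.isBase → β.isBase → (∀ γ ∈ αs, γ.isBase) → (∀ γ ∈ βs, γ.isBase) →
      1 ≤ αs.length + βs.length →
      Prov k ((kConj z.other αs βs).imp ((Form.K z α).imp β)) →
      Prov k ((kConj z.other αs βs).imp (α.imp β))
  | deRe (z : Var) (t : Term Cons) (c : Cons) :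
      Prov k ((Form.eq t (.const c)).imp
        ((Form.Kt z t).iffF (.K z (.eq t (.const c)))))
  | structK {α : Form Pred Cons} (z : Var) (T : Finset (Term Cons)) : α.isBase →
      (∀ t ∈ α.termList, t ∈ T) →
      Prov k (((Form.bigAnd (T.toList.map (Form.Kt z))).and α).imp (.K z α))

/-- A set of formulas is consistent if no finite conjunction from it proves `⊥`. -/
def consistentS {Pred Cons : Type} [Fintype Cons] [DecidableEq Cons] (k : ℕ)
    (Γ : Set (Form Pred Cons)) : Prop :=
  ¬ ∃ l : List (Form Pred Cons), (∀ φ ∈ l, φ ∈ Γ) ∧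
      Prov k ((Form.bigAnd l).imp Form.falseF)

/-- Maximally consistent sets of `L⁻`-formulas. -/
def MCS {Pred Cons : Type} [Fintype Cons] [DecidableEq Cons] (k : ℕ)
    (Δ : Set (Form Pred Cons)) : Prop :=
  consistentS k Δ ∧ (∀ φ ∈ Δ, Form.isStatic φ) ∧
    ∀ φ : Form Pred Cons, φ.isStatic → φ ∈ Δ ∨ Form.neg φ ∈ Δ

/-- All terms of the formula are constants. -/
def isConsOnly {Pred Cons : Type} (φ : Form Pred Cons) : Prop :=
  ∀ t ∈ φ.termList, ∃ c : Cons, t = Term.const c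

/-- `Δ₁ =^Cons Δ₂`: the two sets contain the same `L_B`-formulas whose terms are
all constants. -/
def consEq {Pred Cons : Type} (Δ₁ Δ₂ : Set (Form Pred Cons)) : Prop :=
  ∀ α : Form Pred Cons, α.isBase → isConsOnly α → (α ∈ Δ₁ ↔ α ∈ Δ₂)
/-! ### The canonical model -/

/-- The equivalence class of the constant `c` determined by `Δ₀`. -/
def eqClass {Pred Cons : Type} (Δ₀ : Set (Form Pred Cons)) (c : Cons) : Set Cons :=
  {c' | Form.eq (Term.const c') (Term.const c) ∈ Δ₀}

/-- The canonical domain: equivalence classes of constants. -/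
def CanD {Pred Cons : Type} (Δ₀ : Set (Form Pred Cons)) : Type :=
  {S : Set Cons // ∃ c, S = eqClass Δ₀ c}

/-- `[c]`, as an element of the canonical domain. -/
def canConst {Pred Cons : Type} (Δ₀ : Set (Form Pred Cons)) (c : Cons) : CanD Δ₀ :=
  ⟨eqClass Δ₀ c, c, rfl⟩

/-- The canonical interpretation. -/
def canI {Pred Cons : Type} (Δ₀ : Set (Form Pred Cons)) : Interp Pred Cons (CanD Δ₀) where
  pred P ds := ∃ cs : List Cons, ds = cs.map (canConst Δ₀) ∧
    Form.pred P (cs.map Term.const) ∈ Δ₀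
  rel d₁ d₂ := ∃ c₁ c₂, d₁ = canConst Δ₀ c₁ ∧ d₂ = canConst Δ₀ c₂ ∧
    Form.rel (Term.const c₁) (Term.const c₂) ∈ Δ₀
  const := canConst Δ₀

/-- `K_z Δ := {α : K_z α ∈ Δ}`. -/
def Kset {Pred Cons : Type} (z : Var) (Δ : Set (Form Pred Cons)) : Set (Form Pred Cons) :=
  {α | Form.K z α ∈ Δ}

/-- The canonical set of situations, as a collection of MCSs. -/
def CanSit {Pred Cons : Type} [Fintype Cons] [DecidableEq Cons] (k : ℕ)
    (Δ₀ : Set (Form Pred Cons)) (Ty Tx : Finset Cons) (cx cy : Cons) :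
    Set (Set (Form Pred Cons)) :=
  {Δ₀} ∪
  {Δ | MCS k Δ ∧ consEq Δ Δ₀ ∧ KzEqSet Var.x Var.y Ty ∈ Δ ∧
      Form.K Var.y (Form.eq (.var .x) (.const cx)) ∈ Δ ∧
      ∃ c ∈ Ty, Form.eq (.var .y) (.const c) ∈ Δ ∧
        Form.neg (Form.eq (.const c) (.const cy)) ∈ Δ} ∪
  {Δ | MCS k Δ ∧ consEq Δ Δ₀ ∧ KzEqSet Var.y Var.x Tx ∈ Δ ∧
      Form.K Var.x (Form.eq (.var .y) (.const cy)) ∈ Δ ∧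
      ∃ c ∈ Tx, Form.eq (.var .x) (.const c) ∈ Δ ∧
        Form.neg (Form.eq (.const c) (.const cx)) ∈ Δ}

/-- The assignment induced by an MCS `Δ`: `Δ(z) = [c]` whenever `z ≡ c ∈ Δ`. -/
noncomputable def canAsg {Pred Cons : Type} [Nonempty Cons]
    (Δ₀ Δ : Set (Form Pred Cons)) : Assign (CanD Δ₀) := fun z =>
  canConst Δ₀ (open Classical in
    if h : ∃ c : Cons, Form.eq (Term.var z) (Term.const c) ∈ Δ then h.choose
    else Classical.arbitrary Cons)

/-- The canonical set of situations, as a set of assignments. -/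
noncomputable def CanSitA {Pred Cons : Type} [Fintype Cons] [DecidableEq Cons] [Nonempty Cons]
    (k : ℕ) (Δ₀ : Set (Form Pred Cons)) (Ty Tx : Finset Cons) (cx cy : Cons) :
    Set (Assign (CanD Δ₀)) :=
  canAsg Δ₀ '' CanSit k Δ₀ Ty Tx cx cy

/-- The canonical indistinguishability relations: `Δ₁ ∼_z Δ₂` iff `K_z Δ₁ = K_z Δ₂`. -/
def canSim {Pred Cons : Type} [Nonempty Cons] (Δ₀ : Set (Form Pred Cons))
    (S : Set (Set (Form Pred Cons))) : SimRel (CanD Δ₀) := fun z σ₁ σ₂ =>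
  ∃ Δ₁ ∈ S, ∃ Δ₂ ∈ S, σ₁ = canAsg Δ₀ Δ₁ ∧ σ₂ = canAsg Δ₀ Δ₂ ∧ Kset z Δ₁ = Kset z Δ₂
/-- The set of `L_B`-formulas of `Δ₀` all of whose terms are constants. -/
def GammaSet {Pred Cons : Type} (Δ₀ : Set (Form Pred Cons)) : Set (Form Pred Cons) :=
  {α | α ∈ Δ₀ ∧ α.isBase ∧ isConsOnly α}

theorem Var.other_other (z : Var) : z.other.other = z := by cases z <;> rfl

theorem Var.other_ne (z : Var) : z.other ≠ z := by cases z <;> simp [Var.other]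

theorem Var.eq_or_eq_other (w z : Var) : w = z ∨ w = z.other := by
  cases w <;> cases z <;> simp [Var.other]

namespace Form

variable {Pred Cons : Type}

theorem isBase.isStatic {φ : Form Pred Cons} (h : φ.isBase) : φ.isStatic := by
  induction φ with
  | and φ ψ ihφ ihψ => exact ⟨ihφ h.1, ihψ h.2⟩
  | neg φ ih => exact ih h
  | _ => simp_all [isBase, Form.isStatic]

@[simp] theorem isBase_imp {φ ψ : Form Pred Cons} :
    (φ.imp ψ).isBase ↔ φ.isBase ∧ ψ.isBase := by simp [imp, isBase]

@[simp] theorem isBase_iffF {φ ψ : Form Pred Cons} :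
    (φ.iffF ψ).isBase ↔ φ.isBase ∧ ψ.isBase := by
  simp only [iffF, isBase, isBase_imp]; tauto

@[simp] theorem isBase_or {φ ψ : Form Pred Cons} :
    (φ.or ψ).isBase ↔ φ.isBase ∧ ψ.isBase := by simp [or, isBase]

@[simp] theorem isBase_falseF : (falseF : Form Pred Cons).isBase := by simp [falseF, isBase]

@[simp] theorem isBase_bigAnd {l : List (Form Pred Cons)} :
    (bigAnd l).isBase ↔ ∀ φ ∈ l, φ.isBase := by
  induction l with
  | nil => simp [bigAnd, trueF, isBase]
  | cons φ l ih => simp [bigAnd, isBase, ih]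

@[simp] theorem isBase_bigOr {l : List (Form Pred Cons)} :
    (bigOr l).isBase ↔ ∀ φ ∈ l, φ.isBase := by
  induction l with
  | nil => simp [bigOr]
  | cons φ l ih => simp [bigOr, ih]

@[simp] theorem isStatic_imp {φ ψ : Form Pred Cons} :
    (φ.imp ψ).isStatic ↔ φ.isStatic ∧ ψ.isStatic := by simp [imp, isStatic]

@[simp] theorem isStatic_iffF {φ ψ : Form Pred Cons} :
    (φ.iffF ψ).isStatic ↔ φ.isStatic ∧ ψ.isStatic := by
  simp only [iffF, isStatic, isStatic_imp]; tauto

@[simp] theorem isStatic_or {φ ψ : Form Pred Cons} :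
    (φ.or ψ).isStatic ↔ φ.isStatic ∧ ψ.isStatic := by simp [or, isStatic]

@[simp] theorem isStatic_diaK {z : Var} {φ : Form Pred Cons} :
    (diaK z φ).isStatic ↔ φ.isBase := by simp [diaK, isStatic, isBase]

@[simp] theorem isStatic_falseF : (falseF : Form Pred Cons).isStatic := by
  simp [falseF, isStatic]

@[simp] theorem isStatic_bigAnd {l : List (Form Pred Cons)} :
    (bigAnd l).isStatic ↔ ∀ φ ∈ l, φ.isStatic := by
  induction l with
  | nil => simp [bigAnd, trueF, isStatic]
  | cons φ l ih => simp [bigAnd, isStatic, ih]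

theorem isBase_distForm [Fintype Cons] (n : ℕ) (s t : Term Cons) :
    (distForm Pred n s t).isBase := by
  induction n generalizing t with
  | zero => simp [distForm, isBase]
  | succ n ih => simp [distForm, isBase, ih]

theorem isBase.substC {c : Cons} {z : Var} {φ : Form Pred Cons} (h : φ.isBase) :
    (φ.substC c z).isBase := by
  induction φ with
  | and φ ψ ihφ ihψ => exact ⟨ihφ h.1, ihψ h.2⟩
  | neg φ ih => exact ih h
  | _ => simp_all [isBase, Form.substC]

theorem isBase.replace [DecidableEq Cons] {s t : Term Cons} {φ : Form Pred Cons}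
    (h : φ.isBase) : (φ.replace s t).isBase := by
  induction φ with
  | and φ ψ ihφ ihψ => exact ⟨ihφ h.1, ihψ h.2⟩
  | neg φ ih => exact ih h
  | _ => simp_all [isBase, Form.replace]

theorem termList_replace [DecidableEq Cons] (s t : Term Cons) (φ : Form Pred Cons) :
    (φ.replace s t).termList = φ.termList.map (Term.repl s t) := by
  induction φ <;> simp_all [Form.replace, termList]

section evalProp

variable (v : Form Pred Cons → Prop)

@[simp] theorem evalProp_neg (φ : Form Pred Cons) :
    evalProp v (.neg φ) ↔ ¬ evalProp v φ := by simp [evalProp]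

@[simp] theorem evalProp_and (φ ψ : Form Pred Cons) :
    evalProp v (.and φ ψ) ↔ evalProp v φ ∧ evalProp v ψ := by simp [evalProp]

@[simp] theorem evalProp_imp (φ ψ : Form Pred Cons) :
    evalProp v (φ.imp ψ) ↔ (evalProp v φ → evalProp v ψ) := by simp [imp]

@[simp] theorem evalProp_iffF (φ ψ : Form Pred Cons) :
    evalProp v (φ.iffF ψ) ↔ (evalProp v φ ↔ evalProp v ψ) := by
  simp only [iffF, evalProp_and, evalProp_imp]; tauto

@[simp] theorem evalProp_or (φ ψ : Form Pred Cons) :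
    evalProp v (φ.or ψ) ↔ evalProp v φ ∨ evalProp v ψ := by
  simp only [or, evalProp_and, evalProp_neg]; tauto

@[simp] theorem evalProp_falseF :
    evalProp v falseF ↔ ¬ v (.eq (.var .x) (.var .x)) := by simp [falseF, evalProp]

@[simp] theorem evalProp_bigAnd (l : List (Form Pred Cons)) :
    evalProp v (bigAnd l) ↔ v (.eq (.var .x) (.var .x)) ∧ ∀ φ ∈ l, evalProp v φ := by
  induction l with
  | nil => simp [bigAnd, trueF]
  | cons φ l ih => simp [bigAnd, ih]; tauto

@[simp] theorem evalProp_K (z : Var) (φ : Form Pred Cons) :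
    evalProp v (.K z φ) ↔ v (.K z φ) := by simp [evalProp]

end evalProp

end Form

theorem consEq.eq_const_mem_iff {Pred Cons : Type} {Δ Δ₀ : Set (Form Pred Cons)}
    (h : consEq Δ Δ₀) {c c' : Cons} :
    Form.eq (.const c) (.const c') ∈ Δ ↔ Form.eq (.const c) (.const c') ∈ Δ₀ :=
  h _ (by simp [Form.isBase]) (by simp [isConsOnly, Form.termList])

section

variable {Pred Cons : Type} [Fintype Cons] [DecidableEq Cons] {k : ℕ}

theorem isStatic_KzEqSet (z z' : Var) (T : Finset Cons) :
    (KzEqSet z z' T : Form Pred Cons).isStatic := by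
  unfold KzEqSet
  rw [Form.isStatic_bigAnd]
  intro φ hφ
  simp only [List.mem_append, List.mem_map] at hφ
  obtain ⟨c, -, rfl⟩ | ⟨c, -, rfl⟩ := hφ <;> simp [Form.isStatic, Form.isBase]

namespace Prov

variable {φ ψ : Form Pred Cons}

theorem isStatic (h : Prov k φ) : φ.isStatic := by
  induction h with
  | taut h => exact h
  | mp _ _ ih => exact (Form.isStatic_imp.1 ih).2
  | eqRefl => trivial
  | eqSymm => simp [Form.isStatic]
  | eqTrans => simp [Form.isStatic]
  | eqSubst s t hα => simp [Form.isStatic, hα.isStatic, hα.replace.isStatic]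
  | seriality => exact Form.isBase.isStatic (by simp [Form.isBase])
  | atSomewhere => exact Form.isBase.isStatic (by simp [Form.isBase])
  | ksight z t =>
    exact Form.isStatic_imp.2 ⟨(Form.isBase_distForm k (.var z) t).isStatic, trivial⟩
  | kAx z hα hβ => simp [Form.isStatic, hα, hβ]
  | tAx z hα => simp [Form.isStatic, hα, hα.isStatic]
  | kGround z T hα => simp [Form.isStatic, hα, hα.substC.isStatic, isStatic_KzEqSet]
  | kAdd z αs βs hα _ _ _ _ ih => exact Form.isStatic_imp.2 ⟨(Form.isStatic_imp.1 ih).1, hα⟩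
  | kElim z αs βs hα hβ _ _ _ _ ih =>
    exact Form.isStatic_imp.2
      ⟨(Form.isStatic_imp.1 ih).1, Form.isStatic_imp.2 ⟨hα.isStatic, hβ.isStatic⟩⟩
  | deRe => simp [Form.isStatic, Form.isBase]
  | structK z T hα => simp [Form.isStatic, hα, hα.isStatic]

/-- Provability is closed under tautological consequence. -/
theorem of_tautological (h : Prov k φ) (hψ : ψ.isStatic)
    (hv : ∀ v, Form.evalProp v φ → Form.evalProp v ψ) : Prov k ψ :=
  .mp (.taut (Form.isStatic_imp.2 ⟨h.isStatic, hψ⟩) fun v => by simpa using hv v) h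

theorem and (h : Prov k φ) (h' : Prov k ψ) : Prov k (φ.and ψ) :=
  .mp (h.of_tautological (ψ := ψ.imp (φ.and ψ))
    (Form.isStatic_imp.2 ⟨h'.isStatic, h.isStatic, h'.isStatic⟩) (by simp +contextual)) h'

theorem bigAnd {l : List (Form Pred Cons)} (h : ∀ φ ∈ l, Prov k φ) : Prov k (Form.bigAnd l) := by
  induction l with
  | nil =>
    exact (eqRefl (.var .x)).of_tautological (by simp)
      (by simp [Form.evalProp])
  | cons φ l ih =>
    rw [List.forall_mem_cons] at h
    exact h.1.and (ih h.2)

/-- Necessitation for base formulas, derived from K-additivity. -/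
theorem nec (z : Var) {α : Form Pred Cons} (hα : α.isBase) (h : Prov k α) :
    Prov k (.K z α) := by
  have weaken : ∀ χ : Form Pred Cons, χ.isStatic → Prov k (χ.imp α) := fun χ hχ =>
    h.of_tautological (by simp [hχ, hα.isStatic]) (by simp +contextual)
  have h₁ : Prov k ((kConj z [α.neg.neg] []).imp (.K z α)) :=
    .kAdd z _ _ hα (by simpa [Form.isBase] using hα) (by simp) (by simp)
      (weaken _ (by simpa [kConj, Form.isStatic, Form.isBase] using hα))
  have h₂ : Prov k ((kConj z [] [α.neg]).imp (.K z α)) :=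
    .kAdd z _ _ hα (by simp) (by simpa [Form.isBase] using hα) (by simp)
      (weaken _ (by simpa [kConj, Form.isBase] using hα))
  refine ((h₁.and h₂).and (.eqRefl (.var .x))).of_tautological hα fun v => ?_
  simp [kConj, Form.diaK, Form.evalProp]
  tauto

theorem distForm_self (n : ℕ) (t : Term Cons) : Prov k (distForm Pred n t t) := by
  induction n with
  | zero => exact .eqRefl t
  | succ n ih =>
    exact ih.of_tautological (Form.isBase_distForm (n + 1) t t).isStatic
      (by simp +contextual [distForm])

theorem Kt_self (z : Var) : Prov (Pred := Pred) (Cons := Cons) k (.Kt z (.var z)) :=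
  .mp (.ksight z _) (distForm_self k _)

theorem Kt_const (z : Var) (c : Cons) : Prov (Pred := Pred) k (.Kt z (.const c)) := by
  refine ((mp (deRe z (.const c) c) (eqRefl _)).and
    (nec z (α := .eq (.const c) (.const c)) trivial (eqRefl (.const c)))).of_tautological trivial fun v => ?_
  simp only [Form.evalProp_and, Form.evalProp_iffF]
  tauto

/-- A player knows the truth of facts about constants and her own position. -/
theorem imp_K_of_terms (z : Var) {α : Form Pred Cons} (hα : α.isBase)
    (ht : ∀ t ∈ α.termList, t = .var z ∨ ∃ c, t = .const c) :
    Prov k (α.imp (.K z α)) := by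
  have hKt : ∀ t ∈ α.termList, Prov (Pred := Pred) k (.Kt z t) := by
    intro t h
    obtain rfl | ⟨c, rfl⟩ := ht t h
    exacts [Kt_self z, Kt_const z c]
  have hs := structK (k := k) z α.termList.toFinset hα (by simp)
  refine (hs.and (bigAnd (l := α.termList.toFinset.toList.map (.Kt z)) (by simpa using hKt))
    ).of_tautological (by simp [Form.isStatic, hα, hα.isStatic]) fun v => ?_
  simp only [Form.evalProp_and, Form.evalProp_imp]
  tauto

end Prov

namespace MCS

variable {Δ : Set (Form Pred Cons)} {φ ψ : Form Pred Cons}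

theorem not_neg_mem (hΔ : MCS k Δ) (hφ : φ ∈ Δ) : φ.neg ∉ Δ := fun hn =>
  hΔ.1 ⟨[φ, φ.neg], by simp [hφ, hn], .taut
    (by simp [Form.isStatic, hΔ.2.1 φ hφ]) fun v => by simp +contextual⟩

theorem mem_of_tautological (hΔ : MCS k Δ) (l : List (Form Pred Cons)) (hl : ∀ φ ∈ l, φ ∈ Δ)
    (hψ : ψ.isStatic) (h : ∀ v, (∀ φ ∈ l, Form.evalProp v φ) → Form.evalProp v ψ) : ψ ∈ Δ := by
  refine (hΔ.2.2 ψ hψ).resolve_right fun hn => hΔ.1 ⟨ψ.neg :: l, by simpa [hn] using hl, ?_⟩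
  refine .taut ?_ fun v => ?_
  · simpa [Form.isStatic, hψ] using fun φ hφ => hΔ.2.1 φ (hl φ hφ)
  · simp only [Form.evalProp_imp, Form.evalProp_bigAnd, List.forall_mem_cons, Form.evalProp_neg]
    exact fun hv => absurd (h v hv.2.2) hv.2.1

theorem mem_of_prov (hΔ : MCS k Δ) (h : Prov k φ) : φ ∈ Δ := by
  refine (hΔ.2.2 φ h.isStatic).resolve_right fun hn => hΔ.1 ⟨[φ.neg], by simpa using hn, ?_⟩
  exact h.of_tautological (by simp [Form.isStatic, h.isStatic]) (by simp +contextual)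

theorem neg_mem_iff (hΔ : MCS k Δ) (hφ : φ.isStatic) : φ.neg ∈ Δ ↔ φ ∉ Δ :=
  ⟨fun hn h => hΔ.not_neg_mem h hn, (hΔ.2.2 φ hφ).resolve_left⟩

theorem and_mem_iff (hΔ : MCS k Δ) : φ.and ψ ∈ Δ ↔ φ ∈ Δ ∧ ψ ∈ Δ := by
  refine ⟨fun h => ?_, fun h => ?_⟩
  · have hs := hΔ.2.1 _ h
    exact ⟨hΔ.mem_of_tautological [_] (by simpa using h) hs.1 (by simp +contextual),
      hΔ.mem_of_tautological [_] (by simpa using h) hs.2 (by simp +contextual)⟩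
  · exact hΔ.mem_of_tautological [φ, ψ] (by simpa using h) ⟨hΔ.2.1 _ h.1, hΔ.2.1 _ h.2⟩
      (by simp +contextual)

theorem mem_of_imp (hΔ : MCS k Δ) (h : φ.imp ψ ∈ Δ) (hφ : φ ∈ Δ) : ψ ∈ Δ :=
  hΔ.mem_of_tautological [φ.imp ψ, φ] (by simp [h, hφ])
    (Form.isStatic_imp.1 (hΔ.2.1 _ h)).2 (by simp +contextual)

theorem mem_of_prov_imp (hΔ : MCS k Δ) (h : Prov k (φ.imp ψ)) (hφ : φ ∈ Δ) : ψ ∈ Δ :=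
  hΔ.mem_of_imp (hΔ.mem_of_prov h) hφ

theorem mem_iff_of_iffF (hΔ : MCS k Δ) (h : φ.iffF ψ ∈ Δ) : φ ∈ Δ ↔ ψ ∈ Δ :=
  have h' := hΔ.and_mem_iff.1 h
  ⟨hΔ.mem_of_imp h'.1, hΔ.mem_of_imp h'.2⟩

theorem falseF_notMem (hΔ : MCS k Δ) : Form.falseF ∉ Δ :=
  hΔ.not_neg_mem (hΔ.mem_of_prov (.eqRefl (.var .x)))

theorem bigAnd_mem_iff (hΔ : MCS k Δ) {l : List (Form Pred Cons)} :
    Form.bigAnd l ∈ Δ ↔ ∀ φ ∈ l, φ ∈ Δ := by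
  induction l with
  | nil => simpa [Form.bigAnd, Form.trueF] using
      (hΔ.neg_mem_iff Form.isStatic_falseF).2 hΔ.falseF_notMem
  | cons φ l ih => simp [Form.bigAnd, hΔ.and_mem_iff, ih]

theorem exists_mem_of_bigOr_mem (hΔ : MCS k Δ) {l : List (Form Pred Cons)}
    (h : Form.bigOr l ∈ Δ) : ∃ φ ∈ l, φ ∈ Δ := by
  induction l with
  | nil => exact absurd h hΔ.falseF_notMem
  | cons φ l ih =>
    have hs := Form.isStatic_or.1 (hΔ.2.1 _ h)
    by_cases hφ : φ ∈ Δ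
    · exact ⟨φ, by simp, hφ⟩
    · have hor : φ.or (Form.bigOr l) ∈ Δ := h
      have hl : Form.bigOr l ∈ Δ := by
        refine hΔ.mem_of_tautological [φ.or (Form.bigOr l), φ.neg]
          (by simp [hor, (hΔ.neg_mem_iff hs.1).2 hφ]) hs.2 fun v => ?_
        simp only [List.forall_mem_cons, Form.evalProp_or, Form.evalProp_neg]
        tauto
      obtain ⟨ψ, hψ, hψΔ⟩ := ih hl
      exact ⟨ψ, by simp [hψ], hψΔ⟩

theorem eq_symm (hΔ : MCS k Δ) {s t : Term Cons} (h : Form.eq s t ∈ Δ) : Form.eq t s ∈ Δ :=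
  hΔ.mem_of_prov_imp (.eqSymm s t) h

theorem eq_trans (hΔ : MCS k Δ) {r s t : Term Cons} (h : Form.eq r s ∈ Δ)
    (h' : Form.eq s t ∈ Δ) : Form.eq r t ∈ Δ :=
  hΔ.mem_of_prov_imp (.eqTrans r s t) (hΔ.and_mem_iff.2 ⟨h, h'⟩)

theorem exists_eq_const (hΔ : MCS k Δ) (t : Term Cons) : ∃ c, Form.eq t (.const c) ∈ Δ := by
  cases t with
  | const c => exact ⟨c, hΔ.mem_of_prov (.eqRefl _)⟩
  | var z =>
    have h := hΔ.exists_mem_of_bigOr_mem (hΔ.mem_of_prov (.atSomewhere z))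
    simpa using h

theorem mem_iff_replace (hΔ : MCS k Δ) {s t : Term Cons} (h : Form.eq t s ∈ Δ)
    (hφ : φ.isBase) : φ ∈ Δ ↔ φ.replace s t ∈ Δ :=
  hΔ.mem_iff_of_iffF (hΔ.mem_of_prov_imp (.eqSubst s t hφ) (hΔ.eq_symm h))

theorem mem_of_K_mem (hΔ : MCS k Δ) {z : Var} (h : Form.K z φ ∈ Δ) : φ ∈ Δ :=
  hΔ.mem_of_prov_imp (.tAx z (hΔ.2.1 _ h)) h

theorem K_mem_of_K_imp (hΔ : MCS k Δ) {z : Var} (h : Form.K z (φ.imp ψ) ∈ Δ)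
    (h' : Form.K z φ ∈ Δ) : Form.K z ψ ∈ Δ := by
  have hs : (φ.imp ψ).isBase := hΔ.2.1 _ h
  rw [Form.isBase_imp] at hs
  exact hΔ.mem_of_imp (hΔ.mem_of_prov_imp (.kAx z hs.1 hs.2) h) h'

theorem K_mem_of_prov_imp (hΔ : MCS k Δ) {z : Var} (h : Prov k (φ.imp ψ))
    (hψ : ψ.isBase) (h' : Form.K z φ ∈ Δ) : Form.K z ψ ∈ Δ := by
  have hφ : φ.isBase := hΔ.2.1 _ h'
  have hs : (φ.imp ψ).isBase := by simp [hφ, hψ]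
  exact hΔ.K_mem_of_K_imp (hΔ.mem_of_prov (.nec z hs h)) h'

theorem K_and_mem (hΔ : MCS k Δ) {z : Var} (h : Form.K z φ ∈ Δ) (h' : Form.K z ψ ∈ Δ) :
    Form.K z (φ.and ψ) ∈ Δ := by
  have hφ : φ.isBase := hΔ.2.1 _ h
  have hψ : ψ.isBase := hΔ.2.1 _ h'
  refine hΔ.K_mem_of_K_imp (hΔ.K_mem_of_prov_imp (.taut ?_ ?_) ?_ h) h'
  · simp [Form.isStatic, hφ.isStatic, hψ.isStatic]
  · intro v; simp +contextual
  · simp [Form.isBase, hφ, hψ]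

theorem K_mem_of_terms (hΔ : MCS k Δ) (z : Var) (hφ : φ.isBase)
    (ht : ∀ t ∈ φ.termList, t = .var z ∨ ∃ c, t = .const c) (h : φ ∈ Δ) : Form.K z φ ∈ Δ :=
  hΔ.mem_of_prov_imp (.imp_K_of_terms z hφ ht) h

/-- When `w` knows that `t` is `s`, she knows `φ` iff she knows `φ[s/t]`. -/
theorem K_mem_iff_K_replace (hΔ : MCS k Δ) {w : Var} {s t : Term Cons}
    (h : Form.K w (.eq t s) ∈ Δ) (hφ : φ.isBase) :
    Form.K w φ ∈ Δ ↔ Form.K w (φ.replace s t) ∈ Δ := by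
  have hb := hφ.replace (s := s) (t := t)
  have h₀ : Form.K w (.eq s t) ∈ Δ := hΔ.K_mem_of_prov_imp (.eqSymm t s) (by simp [Form.isBase]) h
  have h₁ : Form.K w (φ.iffF (φ.replace s t)) ∈ Δ :=
    hΔ.K_mem_of_prov_imp (.eqSubst s t hφ) (by simp [hφ, hb]) h₀
  have hs : (φ.iffF (φ.replace s t)).isStatic := by simp [hφ.isStatic, hb.isStatic]
  constructor <;> refine fun h' => hΔ.K_mem_of_K_imp (hΔ.K_mem_of_prov_imp (.taut ?_ ?_) ?_ h₁) h'
  · simp [hφ.isStatic, hb.isStatic]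
  · intro v; simp +contextual
  · simp [hφ, hb]
  · simp [hφ.isStatic, hb.isStatic]
  · intro v; simp +contextual
  · simp [hφ, hb]

end MCS

theorem consistentS.exists_MCS {Γ : Set (Form Pred Cons)} (hΓ : consistentS k Γ)
    (hs : ∀ φ ∈ Γ, φ.isStatic) : ∃ Δ, Γ ⊆ Δ ∧ MCS k Δ := by
  obtain ⟨Δ, hΓΔ, hmax⟩ := zorn_subset_nonempty
    {Δ : Set (Form Pred Cons) | consistentS k Δ ∧ ∀ φ ∈ Δ, φ.isStatic}
    (fun c hc hchain hne => by
      refine ⟨⋃₀ c, ⟨?_, fun φ ⟨S, hS, hφ⟩ => (hc hS).2 φ hφ⟩, fun S => Set.subset_sUnion_of_mem⟩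
      rintro ⟨l, hl, hp⟩
      obtain ⟨S, hS, hlS⟩ := hchain.directedOn.exists_mem_subset_of_finite_of_subset_sUnion hne
        l.finite_toSet (fun φ hφ => hl φ hφ)
      exact (hc hS).1 ⟨l, hlS, hp⟩) Γ ⟨hΓ, hs⟩
  refine ⟨Δ, hΓΔ, hmax.prop.1, hmax.prop.2, fun φ hφ => ?_⟩
  have key : ∀ ψ : Form Pred Cons, ψ.isStatic → ψ ∉ Δ → ∃ l : List (Form Pred Cons),
      (∀ χ ∈ l, χ ∈ Δ) ∧ Prov k ((Form.bigAnd l).imp (ψ.imp Form.falseF)) := by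
    classical
    intro ψ hψ hn
    have : ¬ consistentS k (insert ψ Δ) := fun hc => hn <| hmax.le_of_ge
      ⟨hc, by simpa [hψ] using hmax.prop.2⟩ (Set.subset_insert ψ Δ) (Set.mem_insert ψ Δ)
    obtain ⟨l, hl, hp⟩ := not_not.1 this
    have hls : ∀ χ ∈ l, χ.isStatic := fun χ hχ => by
      obtain rfl | h := hl χ hχ
      exacts [hψ, hmax.prop.2 χ h]
    refine ⟨l.filter (· ∈ Δ), by simp, hp.of_tautological ?_ fun v => ?_⟩
    · simpa [hψ] using fun χ hχ _ => hls χ hχ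
    · simp only [Form.evalProp_imp, Form.evalProp_bigAnd, List.mem_filter, decide_eq_true_eq]
      rintro h ⟨hx, hf⟩ hv
      refine h ⟨hx, fun χ hχ => ?_⟩
      obtain rfl | hχΔ := hl χ hχ
      exacts [hv, hf χ ⟨hχ, hχΔ⟩]
  by_contra! hcon
  obtain ⟨l₁, hl₁, hp₁⟩ := key φ hφ hcon.1
  obtain ⟨l₂, hl₂, hp₂⟩ := key φ.neg hφ hcon.2
  have hs₁ := fun χ hχ => hmax.prop.2 χ (hl₁ χ hχ)
  have hs₂ := fun χ hχ => hmax.prop.2 χ (hl₂ χ hχ)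
  refine hmax.prop.1 ⟨l₁ ++ l₂, fun χ hχ => (List.mem_append.1 hχ).elim (hl₁ χ) (hl₂ χ),
    (hp₁.and hp₂).of_tautological ?_ fun v => ?_⟩
  · simp only [Form.isStatic_imp, Form.isStatic_bigAnd, List.mem_append, Form.isStatic_falseF,
      and_true]
    rintro χ (h | h)
    exacts [hs₁ χ h, hs₂ χ h]
  · simp only [Form.evalProp_and, Form.evalProp_imp, Form.evalProp_bigAnd, List.mem_append,
      Form.evalProp_neg, or_imp, forall_and]
    tauto

/-- If `z` considers it possible that the other player is at `c`, there is a consistent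
description of the situation in which the other player is at `c` and knows where `z` is. -/
theorem consistentS_alternative {Δ₀ : Set (Form Pred Cons)} (hM : MCS k Δ₀) {z : Var}
    {T : Finset Cons} {c d e : Cons} (hT : KzEqSet z z.other T ∈ Δ₀)
    (hd : Form.eq (.var z) (.const d) ∈ Δ₀) (hc : c ∈ T)
    (hce : Form.neg (.eq (.const c) (.const e)) ∈ Δ₀) :
    consistentS k ({KzEqSet z z.other T, Form.eq (.var z.other) (.const c),
      Form.neg (.eq (.const c) (.const e)),
      Form.K z.other (.eq (.var z) (.const d))} ∪ GammaSet Δ₀) := by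
  classical
  rintro ⟨l, hl, hp⟩
  set γ : Form Pred Cons :=
    .and (.neg (.eq (.const c) (.const e))) (.bigAnd (l.filter (· ∈ GammaSet Δ₀))) with hγ
  set αs : List (Form Pred Cons) :=
    Tᶜ.toList.map fun c => .neg (.eq (.var z.other) (.const c)) with hαs
  set βs : List (Form Pred Cons) := T.toList.map fun c => .eq (.var z.other) (.const c) with hβs
  set β : Form Pred Cons := .neg (.and γ (.eq (.var z.other) (.const c))) with hβ
  have hαb : ∀ φ ∈ αs, φ.isBase := by simp [hαs, Form.isBase]
  have hβb : ∀ φ ∈ βs, φ.isBase := by simp [hβs, Form.isBase]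
  have hγb : γ.isBase := by
    simpa [hγ, Form.isBase] using fun φ _ (h : φ ∈ GammaSet Δ₀) => h.2.1
  have hlen : 1 ≤ αs.length + βs.length := by
    have := Finset.card_pos.2 ⟨c, hc⟩
    simp [hβs]; omega
  have hdb : (Form.eq (.var z) (.const d) : Form Pred Cons).isBase := by simp [Form.isBase]
  have hβb' : β.isBase := by simpa [hβ, Form.isBase] using hγb
  have hconj : ∀ v, Form.evalProp v (kConj z αs βs) ↔ Form.evalProp v (KzEqSet z z.other T) := by
    intro v
    simp only [kConj, KzEqSet, Form.evalProp_bigAnd, hαs, hβs, List.map_map, List.mem_append,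
      Function.comp_def]
    simp only [or_comm]
  have hconjs : (kConj z αs βs).isStatic := by
    rw [kConj, Form.isStatic_bigAnd]
    simp only [List.mem_append, List.mem_map]
    rintro _ (⟨φ, hφ, rfl⟩ | ⟨φ, hφ, rfl⟩)
    exacts [hαb φ hφ, Form.isStatic_diaK.2 (hβb φ hφ)]
  have h₁ : Prov k ((kConj z αs βs).imp
      ((Form.K z.other (.eq (.var z) (.const d))).imp β)) := by
    refine hp.of_tautological (by simp [hconjs, hβb'.isStatic, Form.isStatic, hdb]) fun v => ?_
    rw [Form.evalProp_imp v (kConj z αs βs), hconj]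
    simp only [Form.evalProp_imp, Form.evalProp_bigAnd, hβ, hγ,
      Form.evalProp_neg, Form.evalProp_and, List.mem_filter, decide_eq_true_eq]
    rintro h hK hKd ⟨⟨hv, hx, hf⟩, hyc⟩
    refine Form.evalProp_falseF v |>.1 (h ⟨hx, fun φ hφ => ?_⟩) hx
    obtain h' | h' := hl φ hφ
    · simp only [Set.mem_insert_iff, Set.mem_singleton_iff] at h'
      obtain rfl | rfl | rfl | rfl := h'
      exacts [hK, hyc, by simpa using hv, hKd]
    · exact hf φ ⟨hφ, h'⟩
  have h₂ : Prov k ((kConj z αs βs).imp ((Form.eq (.var z) (.const d)).imp β)) := by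
    have h := Prov.kElim (k := k) z.other (α := .eq (.var z) (.const d)) αs βs hdb hβb' hαb hβb hlen
    rw [Var.other_other] at h
    exact h h₁
  have h₃ := Prov.kAdd z αs βs (by simp [hdb, hβb']) hαb hβb hlen h₂
  have hconjM : kConj z αs βs ∈ Δ₀ :=
    hM.mem_of_tautological [_] (by simpa using hT) hconjs fun v hv =>
      (hconj v).2 (hv _ (by simp))
  have h₄ : Form.K z β ∈ Δ₀ :=
    hM.K_mem_of_K_imp (hM.mem_of_prov_imp h₃ hconjM)
      (hM.K_mem_of_terms z hdb (by simp [Form.termList]) hd)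
  have hγK : Form.K z γ ∈ Δ₀ := by
    refine hM.K_and_mem (hM.K_mem_of_terms z (by simp [Form.isBase]) (by simp [Form.termList]) hce) ?_
    have : ∀ l : List (Form Pred Cons), (∀ φ ∈ l, φ ∈ GammaSet Δ₀) →
        Form.K z (Form.bigAnd l) ∈ Δ₀ := by
      intro l hl
      induction l with
      | nil =>
        exact hM.mem_of_prov (.nec z (by simp) (.bigAnd (by simp)))
      | cons φ l ih =>
        simp only [List.forall_mem_cons] at hl
        exact hM.K_and_mem (hM.K_mem_of_terms z hl.1.2.1 (fun t ht => .inr (hl.1.2.2 t ht)) hl.1.1)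
          (ih hl.2)
    exact this _ (by simp)
  have h₅ : Form.K z (.neg (.eq (.var z.other) (.const c))) ∈ Δ₀ := by
    refine hM.K_mem_of_prov_imp (.taut ?_ ?_) (by simp [Form.isBase]) (hM.K_and_mem h₄ hγK)
    · simp [Form.isStatic, hβb'.isStatic, hγb.isStatic]
    · intro v; simp +contextual [hβ]
  exact hM.not_neg_mem h₅ (hM.bigAnd_mem_iff.1 hT _ (by
    simp only [List.mem_append, List.mem_map]
    exact .inl ⟨c, by simpa using hc, rfl⟩))

theorem MCS.consEq_of_GammaSet_subset {Δ₀ Δ : Set (Form Pred Cons)} (hM : MCS k Δ₀)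
    (hΔ : MCS k Δ) (h : GammaSet Δ₀ ⊆ Δ) : consEq Δ Δ₀ := by
  refine fun α hα hc => ⟨fun hαΔ => ?_, fun hα₀ => h ⟨hα₀, hα, hc⟩⟩
  by_contra hn
  exact hΔ.not_neg_mem hαΔ (h ⟨(hM.neg_mem_iff hα.isStatic).2 hn, hα, hc⟩)

theorem MCS.eqClass_eq_iff {Δ₀ : Set (Form Pred Cons)} (hM : MCS k Δ₀) {c c' : Cons} :
    eqClass Δ₀ c = eqClass Δ₀ c' ↔ Form.eq (.const c) (.const c') ∈ Δ₀ := by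
  constructor
  · intro h
    have : c ∈ eqClass Δ₀ c := hM.mem_of_prov (.eqRefl _)
    rwa [h] at this
  · intro h
    ext a
    exact ⟨fun ha => hM.eq_trans ha h, fun ha => hM.eq_trans ha (hM.eq_symm h)⟩

/-- An MCS in which `z` considers exactly `T` possible for the other player, who in turn knows
where `z` is, is determined by the constant facts and the two positions. -/
theorem MCS.eq_of_positions {Δ₁ Δ₂ : Set (Form Pred Cons)} (h₁ : MCS k Δ₁) (h₂ : MCS k Δ₂)
    (hcons : consEq Δ₁ Δ₂) {z : Var} {T : Finset Cons} {c d : Cons}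
    (hT₁ : KzEqSet z z.other T ∈ Δ₁) (hT₂ : KzEqSet z z.other T ∈ Δ₂)
    (hK₁ : Form.K z.other (.eq (.var z) (.const d)) ∈ Δ₁)
    (hK₂ : Form.K z.other (.eq (.var z) (.const d)) ∈ Δ₂)
    (hc₁ : Form.eq (.var z.other) (.const c) ∈ Δ₁)
    (hc₂ : Form.eq (.var z.other) (.const c) ∈ Δ₂) : Δ₁ = Δ₂ := by
  have hbase : ∀ α : Form Pred Cons, α.isBase → (α ∈ Δ₁ ↔ α ∈ Δ₂) := by
    intro α hα
    rw [h₁.mem_iff_replace (h₁.mem_of_K_mem hK₁) hα, h₁.mem_iff_replace hc₁ hα.replace,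
      h₂.mem_iff_replace (h₂.mem_of_K_mem hK₂) hα, h₂.mem_iff_replace hc₂ hα.replace]
    refine hcons _ hα.replace.replace fun t ht => ?_
    simp only [Form.termList_replace, List.mem_map] at ht
    obtain ⟨_, ⟨s, -, rfl⟩, rfl⟩ := ht
    cases s with
    | const a => exact ⟨a, by simp [Term.repl]⟩
    | var w => obtain rfl | rfl := w.eq_or_eq_other z <;> simp [Term.repl, Var.other_ne]
  have hground : ∀ {Δ : Set (Form Pred Cons)}, MCS k Δ → KzEqSet z z.other T ∈ Δ →
      ∀ α : Form Pred Cons, α.isBase → (Form.K z α ∈ Δ ↔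
        Form.bigAnd (T.toList.map fun c => α.substC c z.other) ∈ Δ) := by
    intro Δ hΔ hT α hα
    exact hΔ.mem_iff_of_iffF (hΔ.mem_of_prov_imp (.kGround z T hα) hT)
  have hother : ∀ {Δ : Set (Form Pred Cons)}, MCS k Δ →
      Form.K z.other (.eq (.var z) (.const d)) ∈ Δ → ∀ α : Form Pred Cons, α.isBase →
        (Form.K z.other α ∈ Δ ↔ α.replace (.const d) (.var z) ∈ Δ) := by
    intro Δ hΔ hK α hα
    rw [hΔ.K_mem_iff_K_replace hK hα]
    refine ⟨hΔ.mem_of_K_mem, hΔ.K_mem_of_terms _ hα.replace fun t ht => ?_⟩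
    simp only [Form.termList_replace, List.mem_map] at ht
    obtain ⟨s, -, rfl⟩ := ht
    cases s with
    | const a => exact .inr ⟨a, by simp [Term.repl]⟩
    | var w => obtain rfl | rfl := w.eq_or_eq_other z <;> simp [Term.repl, Var.other_ne]
  have hknow : ∀ (w : Var) (α : Form Pred Cons), α.isBase →
      (Form.K w α ∈ Δ₁ ↔ Form.K w α ∈ Δ₂) := by
    intro w α hα
    obtain rfl | rfl := w.eq_or_eq_other z
    · rw [hground h₁ hT₁ α hα, hground h₂ hT₂ α hα]
      exact hbase _ (by simp [hα.substC])
    · rw [hother h₁ hK₁ α hα, hother h₂ hK₂ α hα]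
      exact hbase _ hα.replace
  have hstat : ∀ φ : Form Pred Cons, φ.isStatic → (φ ∈ Δ₁ ↔ φ ∈ Δ₂) := by
    intro φ
    induction φ with
    | pred P args => exact fun _ => hbase _ trivial
    | rel s t => exact fun _ => hbase _ trivial
    | eq s t => exact fun _ => hbase _ trivial
    | neg φ ih =>
      intro h
      rw [h₁.neg_mem_iff (φ := φ) h, h₂.neg_mem_iff (φ := φ) h, ih h]
    | and φ ψ ihφ ihψ =>
      intro h
      rw [h₁.and_mem_iff, h₂.and_mem_iff, ihφ h.1, ihψ h.2]
    | Kt w t =>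
      intro _
      obtain ⟨a, ha⟩ := h₁.exists_eq_const t
      have ha' := (hbase (.eq t (.const a)) trivial).1 ha
      rw [h₁.mem_iff_of_iffF (h₁.mem_of_prov_imp (.deRe w t a) ha),
        h₂.mem_iff_of_iffF (h₂.mem_of_prov_imp (.deRe w t a) ha')]
      exact hknow w (.eq t (.const a)) trivial
    | K w α => exact hknow w α
    | box => exact fun h => h.elim
  ext φ
  exact ⟨fun h => (hstat φ (h₁.2.1 φ h)).1 h, fun h => (hstat φ (h₂.2.1 φ h)).2 h⟩

end

/-- Properties of the canonical set of situations:
(1) consistency of the defining sets with `Γ`, and existence of corresponding MCSs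
in `Σ`; (2) each `Δ ∈ Σ` assigns exactly one value to each variable;
(3) the assignment determines the MCS. -/
theorem canonical_situations {Pred Cons : Type} [Fintype Cons] [DecidableEq Cons]
    [Nonempty Cons] (k : ℕ) (Δ₀ : Set (Form Pred Cons)) (Ty Tx : Finset Cons)
    (cx cy : Cons) (hM : MCS k Δ₀)
    (h₁ : KzEqSet Var.x Var.y Ty ∈ Δ₀) (h₂ : KzEqSet Var.y Var.x Tx ∈ Δ₀)
    (h₃ : Form.eq (Term.var .x) (Term.const cx) ∈ Δ₀)
    (h₄ : Form.eq (Term.var .y) (Term.const cy) ∈ Δ₀) :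
    (∀ c ∈ Ty, Form.neg (Form.eq (Term.const c) (Term.const cy)) ∈ Δ₀ →
      consistentS k
        ({KzEqSet Var.x Var.y Ty, Form.eq (Term.var .y) (Term.const c),
          Form.neg (Form.eq (Term.const c) (Term.const cy)),
          Form.K Var.y (Form.eq (Term.var .x) (Term.const cx))} ∪ GammaSet Δ₀) ∧
      ∃ Δ ∈ CanSit k Δ₀ Ty Tx cx cy,
        ({KzEqSet Var.x Var.y Ty, Form.eq (Term.var .y) (Term.const c),
          Form.neg (Form.eq (Term.const c) (Term.const cy)),
          Form.K Var.y (Form.eq (Term.var .x) (Term.const cx))} ∪ GammaSet Δ₀) ⊆ Δ) ∧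
    (∀ c ∈ Tx, Form.neg (Form.eq (Term.const c) (Term.const cx)) ∈ Δ₀ →
      consistentS k
        ({KzEqSet Var.y Var.x Tx, Form.eq (Term.var .x) (Term.const c),
          Form.neg (Form.eq (Term.const c) (Term.const cx)),
          Form.K Var.x (Form.eq (Term.var .y) (Term.const cy))} ∪ GammaSet Δ₀) ∧
      ∃ Δ ∈ CanSit k Δ₀ Ty Tx cx cy,
        ({KzEqSet Var.y Var.x Tx, Form.eq (Term.var .x) (Term.const c),
          Form.neg (Form.eq (Term.const c) (Term.const cx)),
          Form.K Var.x (Form.eq (Term.var .y) (Term.const cy))} ∪ GammaSet Δ₀) ⊆ Δ) ∧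
    (∀ Δ ∈ CanSit k Δ₀ Ty Tx cx cy, ∀ z : Var,
      ∃! d : CanD Δ₀, ∃ c : Cons,
        Form.eq (Term.var z) (Term.const c) ∈ Δ ∧ d = canConst Δ₀ c) ∧
    (∀ Δ₁ ∈ CanSit k Δ₀ Ty Tx cx cy, ∀ Δ₂ ∈ CanSit k Δ₀ Ty Tx cx cy,
      (∀ (z : Var) (c₁ c₂ : Cons),
        Form.eq (Term.var z) (Term.const c₁) ∈ Δ₁ →
        Form.eq (Term.var z) (Term.const c₂) ∈ Δ₂ →
        eqClass Δ₀ c₁ = eqClass Δ₀ c₂) →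
      Δ₁ = Δ₂) := by
  have hmem : ∀ Δ ∈ CanSit k Δ₀ Ty Tx cx cy, MCS k Δ ∧ consEq Δ Δ₀ := by
    rintro Δ ((rfl | h) | h)
    exacts [⟨hM, fun _ _ _ => Iff.rfl⟩, ⟨h.1, h.2.1⟩, ⟨h.1, h.2.1⟩]
  have hstatic : ∀ (z : Var) (T : Finset Cons) (c d e : Cons),
      ∀ φ ∈ ({KzEqSet z z.other T, Form.eq (Term.var z.other) (Term.const c),
        Form.neg (Form.eq (Term.const c) (Term.const e)),
        Form.K z.other (Form.eq (Term.var z) (Term.const d))} ∪ GammaSet Δ₀ :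
          Set (Form Pred Cons)), φ.isStatic := by
    rintro z T c d e φ ((rfl | rfl | rfl | rfl) | h)
    · exact isStatic_KzEqSet _ _ _
    · trivial
    · trivial
    · trivial
    · exact h.2.1.isStatic
  refine ⟨fun c hc hce => ?_, fun c hc hce => ?_, fun Δ hΔ z => ?_, ?_⟩
  · have hcon := consistentS_alternative hM (z := .x) h₁ h₃ hc hce
    refine ⟨hcon, ?_⟩
    obtain ⟨Δ, hsub, hΔ⟩ := hcon.exists_MCS (hstatic .x Ty c cx cy)
    refine ⟨Δ, .inl (.inr ⟨hΔ, hM.consEq_of_GammaSet_subset hΔ fun φ h => hsub (.inr h),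
      ?_, ?_, c, hc, ?_, ?_⟩), hsub⟩ <;> exact hsub (.inl (by simp [Var.other]))
  · have hcon := consistentS_alternative hM (z := .y) h₂ h₄ hc hce
    refine ⟨hcon, ?_⟩
    obtain ⟨Δ, hsub, hΔ⟩ := hcon.exists_MCS (hstatic .y Tx c cy cx)
    refine ⟨Δ, .inr ⟨hΔ, hM.consEq_of_GammaSet_subset hΔ fun φ h => hsub (.inr h),
      ?_, ?_, c, hc, ?_, ?_⟩, hsub⟩ <;> exact hsub (.inl (by simp [Var.other]))
  · obtain ⟨hm, hcons⟩ := hmem Δ hΔ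
    obtain ⟨c, hc⟩ := hm.exists_eq_const (.var z)
    refine ⟨canConst Δ₀ c, ⟨c, hc, rfl⟩, ?_⟩
    rintro _ ⟨c', hc', rfl⟩
    exact Subtype.ext (hM.eqClass_eq_iff.2 (hcons.eq_const_mem_iff.1
      (hm.eq_trans (hm.eq_symm hc') hc)))
  · have hsame : ∀ Δ ∈ CanSit k Δ₀ Ty Tx cx cy, ∀ (z : Var) (c c' : Cons),
        Form.eq (.const c) (.const c') ∈ Δ₀ → Form.eq (.var z) (.const c) ∈ Δ →
        Form.eq (.var z) (.const c') ∈ Δ := fun Δ hΔ z c c' h hz =>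
      (hmem Δ hΔ).1.eq_trans hz ((hmem Δ hΔ).2.eq_const_mem_iff.2 h)
    have hdiff : ∀ Δ ∈ CanSit k Δ₀ Ty Tx cx cy, ∀ c c' : Cons,
        Form.neg (.eq (.const c) (.const c')) ∈ Δ → Form.eq (.const c) (.const c') ∉ Δ₀ :=
      fun Δ hΔ c c' hn h => (hmem Δ hΔ).1.not_neg_mem ((hmem Δ hΔ).2.eq_const_mem_iff.2 h) hn
    have hcons : ∀ Δ₁ ∈ CanSit k Δ₀ Ty Tx cx cy, ∀ Δ₂ ∈ CanSit k Δ₀ Ty Tx cx cy,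
        consEq Δ₁ Δ₂ := fun Δ₁ m₁ Δ₂ m₂ α hα hc =>
      ((hmem Δ₁ m₁).2 α hα hc).trans ((hmem Δ₂ m₂).2 α hα hc).symm
    intro Δ₁ m₁ Δ₂ m₂ H
    have H' : ∀ (z : Var) (c₁ c₂ : Cons), Form.eq (.var z) (.const c₁) ∈ Δ₁ →
        Form.eq (.var z) (.const c₂) ∈ Δ₂ → Form.eq (.const c₁) (.const c₂) ∈ Δ₀ :=
      fun z c₁ c₂ e₁ e₂ => hM.eqClass_eq_iff.1 (H z c₁ c₂ e₁ e₂)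
    have H'' : ∀ (z : Var) (c₁ c₂ : Cons), Form.eq (.var z) (.const c₁) ∈ Δ₁ →
        Form.eq (.var z) (.const c₂) ∈ Δ₂ → Form.eq (.const c₂) (.const c₁) ∈ Δ₀ :=
      fun z c₁ c₂ e₁ e₂ => hM.eq_symm (H' z c₁ c₂ e₁ e₂)
    rcases id m₁ with (rfl | ⟨M₁, -, T₁, K₁, c₁, -, e₁, n₁⟩) | ⟨M₁, -, T₁, K₁, c₁, -, e₁, n₁⟩ <;>
    rcases id m₂ with (rfl | ⟨M₂, -, T₂, K₂, c₂, -, e₂, n₂⟩) | ⟨M₂, -, T₂, K₂, c₂, -, e₂, n₂⟩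
    · rfl
    · exact absurd (H'' _ _ _ h₄ e₂) (hdiff _ m₂ _ _ n₂)
    · exact absurd (H'' _ _ _ h₃ e₂) (hdiff _ m₂ _ _ n₂)
    · exact absurd (H' _ _ _ e₁ h₄) (hdiff _ m₁ _ _ n₁)
    · exact M₁.eq_of_positions M₂ (hcons _ m₁ _ m₂) (z := .x) T₁ T₂ K₁ K₂ e₁
        (hsame _ m₂ _ _ _ (H'' _ _ _ e₁ e₂) e₂)
    · exact absurd (H'' _ _ _ (M₁.mem_of_K_mem K₁) e₂) (hdiff _ m₂ _ _ n₂)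
    · exact absurd (H' _ _ _ e₁ h₃) (hdiff _ m₁ _ _ n₁)
    · exact absurd (H' _ _ _ e₁ (M₂.mem_of_K_mem K₂)) (hdiff _ m₁ _ _ n₁)
    · exact M₁.eq_of_positions M₂ (hcons _ m₁ _ m₂) (z := .y) T₁ T₂ K₁ K₂ e₁
        (hsame _ m₂ _ _ _ (H'' _ _ _ e₁ e₂) e₂)
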